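/- Let F be a number field with ring of integers O_F, and let P₀ be a finite set of finite places of F (nonzero prime ideals of O_F). Then there exists a finite set S of finite places of F, disjoint from P₀, such that the natural map O_F^×/(O_F^×)² → ∏_{v∈S} k(v)^×/(k(v)^×)², induced by reduction of units modulo each prime v ∈ S, is injective. -/

import Mathlib

open NumberField IsDedekindDomain
open Filter Topology
open scoped ENNReal

/-- The formal Euler product `∏ₐ (1 - f a)⁻¹`, expanded as the sum over all finite multisets of
the products of the values of `f`. -/
noncomputable def multisetSum {α : Type*} (f : α → ℝ≥0∞) : ℝ≥0∞ :=
  ∑' m : Multiset α, (m.map f).prod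

theorem multiset_filterMap_none {α β : Type*} (m : Multiset α) :
    m.filterMap (fun _ => (none : Option β)) = 0 :=
  Multiset.eq_zero_of_forall_notMem fun x hx => by simp [Multiset.mem_filterMap] at hx

theorem multisetSum_mul_le {α β : Type*} (f : α → ℝ≥0∞) (g : β → ℝ≥0∞) :
    multisetSum f * multisetSum g ≤ multisetSum (Sum.elim f g) := by
  have hinj : Function.Injective
      (fun p : Multiset α × Multiset β => p.1.map Sum.inl + p.2.map (Sum.inr : β → α ⊕ β)) := by
    rintro ⟨a, b⟩ ⟨c, d⟩ h
    have h1 := congrArg (Multiset.filterMap Sum.getLeft?) h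
    have h2 := congrArg (Multiset.filterMap Sum.getRight?) h
    simp only [Multiset.filterMap_add, Multiset.filterMap_map, Function.comp_def,
      Sum.getLeft?_inl, Sum.getLeft?_inr, Sum.getRight?_inl, Sum.getRight?_inr] at h1 h2
    simpa [multiset_filterMap_none] using And.intro h1 h2
  calc multisetSum f * multisetSum g
      = ∑' p : Multiset α × Multiset β, (p.1.map f).prod * (p.2.map g).prod := by
        rw [ENNReal.tsum_prod']
        simp_rw [ENNReal.tsum_mul_left, ENNReal.tsum_mul_right]
        rfl
    _ = ∑' p : Multiset α × Multiset β,
        ((p.1.map Sum.inl + p.2.map (Sum.inr : β → α ⊕ β)).map (Sum.elim f g)).prod := by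
        simp [Function.comp_def]
    _ ≤ _ := ENNReal.tsum_comp_le_tsum_of_injective hinj
        (fun m => (m.map (Sum.elim f g)).prod)

theorem multisetSum_mono {α : Type*} {f g : α → ℝ≥0∞} (h : ∀ a, f a ≤ g a) :
    multisetSum f ≤ multisetSum g :=
  ENNReal.tsum_le_tsum fun _ => Multiset.prod_map_le_prod_map f g fun a _ => h a

theorem multisetSum_le_update_add {α : Type*} [DecidableEq α] (f : α → ℝ≥0∞) (p : α) :
    multisetSum f ≤ multisetSum (Function.update f p 0) + f p * multisetSum f := by
  calc multisetSum f
      = ∑' m : ({m : Multiset α | p ∈ m}ᶜ : Set (Multiset α)), ((m : Multiset α).map f).prod +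
          ∑' m : {m : Multiset α | p ∈ m}, ((m : Multiset α).map f).prod := by
        rw [add_comm]
        exact (ENNReal.summable.tsum_add_tsum_compl ENNReal.summable).symm
    _ ≤ _ := by
        gcongr
        · calc _ = ∑' m : ({m : Multiset α | p ∈ m}ᶜ : Set (Multiset α)),
                ((m : Multiset α).map (Function.update f p 0)).prod := by
                refine tsum_congr fun m => ?_
                refine congrArg _ (Multiset.map_congr rfl fun a ha => ?_)
                rw [Function.update_of_ne]
                rintro rfl
                exact m.2 ha
            _ ≤ _ := ENNReal.tsum_comp_le_tsum_of_injective Subtype.val_injective _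
        · calc _ = ∑' m : {m : Multiset α | p ∈ m},
                f p * (((m : Multiset α).erase p).map f).prod := by
                refine tsum_congr fun m => ?_
                conv_lhs => rw [← Multiset.cons_erase m.2]
                simp
            _ = f p * ∑' m : {m : Multiset α | p ∈ m},
                (((m : Multiset α).erase p).map f).prod := ENNReal.tsum_mul_left
            _ ≤ _ := by
                gcongr
                refine ENNReal.tsum_comp_le_tsum_of_injective
                  (f := fun m : {m : Multiset α | p ∈ m} => (m : Multiset α).erase p) ?_
                  (fun m => (m.map f).prod)
                intro a b h
                ext1
                rw [← Multiset.cons_erase a.2, ← Multiset.cons_erase b.2]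
                exact congrArg _ h

theorem multisetSum_le_two_mul_update {α : Type*} [DecidableEq α] {f : α → ℝ≥0∞} {p : α}
    (hp : f p ≤ 2⁻¹) (hf : multisetSum f ≠ ⊤) :
    multisetSum f ≤ 2 * multisetSum (Function.update f p 0) := by
  have h : multisetSum f ≤ multisetSum (Function.update f p 0) + 2⁻¹ * multisetSum f :=
    (multisetSum_le_update_add f p).trans (by gcongr)
  have h2 : 2⁻¹ * multisetSum f + 2⁻¹ * multisetSum f = multisetSum f := by
    rw [← add_mul, ENNReal.inv_two_add_inv_two, one_mul]
  have h3 : 2⁻¹ * multisetSum f ≤ multisetSum (Function.update f p 0) := by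
    refine (ENNReal.add_le_add_iff_right (a := 2⁻¹ * multisetSum f) ?_).1 ?_
    · exact ENNReal.mul_ne_top (by simp) hf
    · rwa [h2]
  calc multisetSum f = 2 * (2⁻¹ * multisetSum f) := by
        rw [two_mul, h2]
    _ ≤ _ := by gcongr

theorem multisetSum_le_two_pow_mul {α : Type*} {f : α → ℝ≥0∞} (hf : ∀ a, f a ≤ 2⁻¹)
    (hfin : multisetSum f ≠ ⊤) (T : Finset α) :
    multisetSum f ≤ 2 ^ T.card * multisetSum (fun a : {a // a ∉ T} => f a) := by
  classical
  have key : multisetSum f ≤ 2 ^ T.card * multisetSum (fun a => if a ∈ T then 0 else f a) := by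
    induction T using Finset.induction_on with
    | empty => simp
    | insert p T hp ih =>
      refine ih.trans ?_
      rw [Finset.card_insert_of_notMem hp, pow_succ, mul_assoc]
      gcongr
      have hupd : (fun a => if a ∈ insert p T then 0 else f a) =
          Function.update (fun a => if a ∈ T then 0 else f a) p 0 := by
        ext a
        by_cases h : a = p <;> simp [h]
      rw [hupd]
      refine multisetSum_le_two_mul_update ?_ ?_
      · rw [if_neg hp]
        exact hf p
      · refine ne_top_of_le_ne_top hfin (multisetSum_mono fun a => ?_)
        split_ifs <;> simp
  refine key.trans (mul_le_mul_right (le_of_eq ?_) _)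
  rw [multisetSum, multisetSum, ← (Multiset.map_injective
    (Subtype.val_injective (p := fun a => a ∉ T))).tsum_eq]
  · refine tsum_congr fun m => ?_
    rw [Multiset.map_map]
    congr 1
    exact Multiset.map_congr rfl fun a _ => if_neg a.2
  · intro m hm
    have h : ∀ a ∈ m, a ∉ T := by
      intro a ha haT
      refine hm (Multiset.prod_eq_zero (Multiset.mem_map.2 ⟨a, ha, if_pos haT⟩))
    lift m to Multiset {a // a ∉ T} using h
    exact ⟨m, rfl⟩

/-- The sum of `N(I)^(-s)` over the nonzero ideals `I` of `𝓞 K`, as an extended real. -/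
noncomputable def idealSum (K : Type*) [Field K] [NumberField K] (s : ℝ) : ℝ≥0∞ :=
  ∑' I : {I : Ideal (𝓞 K) // I ≠ ⊥}, (Ideal.absNorm I.1 : ℝ≥0∞) ^ (-s)

theorem absNorm_multiset_prod_rpow {R β : Type*} [CommRing R] [IsDedekindDomain R]
    [Module.Free ℤ R] (Q : β → Ideal R) (m : Multiset β) (s : ℝ) :
    (Ideal.absNorm (m.map Q).prod : ℝ≥0∞) ^ (-s) =
      (m.map fun b => (Ideal.absNorm (Q b) : ℝ≥0∞) ^ (-s)).prod := by
  induction m using Multiset.induction_on with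
  | empty => simp
  | cons a m ih =>
    simp only [Multiset.map_cons, Multiset.prod_cons, map_mul, Nat.cast_mul, ← ih]
    exact ENNReal.mul_rpow_of_ne_top (by simp) (by simp) _

theorem multisetSum_absNorm_le_idealSum {K β : Type*} [Field K] [NumberField K]
    {Q : β → Ideal (𝓞 K)} (hQ : Function.Injective Q) (hprime : ∀ b, Prime (Q b)) (s : ℝ) :
    multisetSum (fun b => (Ideal.absNorm (Q b) : ℝ≥0∞) ^ (-s)) ≤ idealSum K s := by
  have hne (m : Multiset β) : (m.map Q).prod ≠ ⊥ := by
    rw [← Ideal.zero_eq_bot, Ne, Multiset.prod_eq_zero_iff, Multiset.mem_map]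
    rintro ⟨b, -, hb⟩
    exact (hprime b).ne_zero hb
  have hinj : Function.Injective
      (fun m : Multiset β => (⟨(m.map Q).prod, hne m⟩ : {I : Ideal (𝓞 K) // I ≠ ⊥})) := by
    intro a b h
    refine Multiset.map_injective hQ ?_
    have hp (m : Multiset β) : ∀ p ∈ m.map Q, Prime p := by
      intro p hp
      obtain ⟨b, -, rfl⟩ := Multiset.mem_map.1 hp
      exact hprime b
    rw [← UniqueFactorizationMonoid.normalizedFactors_prod_of_prime (hp a),
      ← UniqueFactorizationMonoid.normalizedFactors_prod_of_prime (hp b)]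
    exact congrArg _ (congrArg Subtype.val h)
  simp_rw [multisetSum, ← absNorm_multiset_prod_rpow]
  exact ENNReal.tsum_comp_le_tsum_of_injective hinj
    (fun I => (Ideal.absNorm I.1 : ℝ≥0∞) ^ (-s))

theorem idealSum_eq_multisetSum (K : Type*) [Field K] [NumberField K] (s : ℝ) :
    idealSum K s = multisetSum
      (fun v : HeightOneSpectrum (𝓞 K) => (Ideal.absNorm v.asIdeal : ℝ≥0∞) ^ (-s)) := by
  refine le_antisymm ?_ (multisetSum_absNorm_le_idealSum
    (fun v w h => HeightOneSpectrum.ext h) (fun v => v.prime) s)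
  have h (I : {I : Ideal (𝓞 K) // I ≠ ⊥}) :
      ∃ m : Multiset (HeightOneSpectrum (𝓞 K)), (m.map HeightOneSpectrum.asIdeal).prod = I.1 := by
    obtain ⟨m, hm⟩ : ∃ m : Multiset (HeightOneSpectrum (𝓞 K)),
        m.map HeightOneSpectrum.asIdeal =
          UniqueFactorizationMonoid.normalizedFactors I.1 := by
      have : CanLift (Ideal (𝓞 K)) (HeightOneSpectrum (𝓞 K)) HeightOneSpectrum.asIdeal Prime :=
        ⟨fun _ hp => ⟨.ofPrime hp, rfl⟩⟩
      exact CanLift.prf _ (UniqueFactorizationMonoid.prime_of_normalized_factor (a := I.1))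
    exact ⟨m, by rw [hm, Ideal.prod_normalizedFactors_eq_self I.2]⟩
  choose φ hφ using h
  have hinj : Function.Injective φ := fun I J hIJ => by
    ext1
    rw [← hφ, hIJ, hφ]
  calc idealSum K s = ∑' I, ((φ I).map fun v : HeightOneSpectrum (𝓞 K) =>
        (Ideal.absNorm v.asIdeal : ℝ≥0∞) ^ (-s)).prod := by
        simp_rw [← absNorm_multiset_prod_rpow, hφ]
        rfl
    _ ≤ _ := ENNReal.tsum_comp_le_tsum_of_injective hinj _

theorem idealSum_eq_tsum_card (K : Type*) [Field K] [NumberField K] (s : ℝ) :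
    idealSum K s = ∑' n : ℕ, if n = 0 then 0 else
      (Nat.card {I : Ideal (𝓞 K) // Ideal.absNorm I = n} : ℝ≥0∞) * (n : ℝ≥0∞) ^ (-s) := by
  rw [idealSum, ← (Equiv.sigmaFiberEquiv
    fun I : {I : Ideal (𝓞 K) // I ≠ ⊥} => Ideal.absNorm I.1).tsum_eq, ENNReal.tsum_sigma']
  refine tsum_congr fun n => ?_
  rcases eq_or_ne n 0 with rfl | hn
  · have : IsEmpty {I : {I : Ideal (𝓞 K) // I ≠ ⊥} // Ideal.absNorm I.1 = 0} :=
      ⟨fun I => I.1.2 (Ideal.absNorm_eq_zero_iff.1 I.2)⟩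
    simp
  · rw [if_neg hn]
    have hfin : Finite {I : Ideal (𝓞 K) // Ideal.absNorm I = n} :=
      Ideal.finite_setOfPred_absNorm_eq n
    let e : {I : {I : Ideal (𝓞 K) // I ≠ ⊥} // Ideal.absNorm I.1 = n} ≃
        {I : Ideal (𝓞 K) // Ideal.absNorm I = n} :=
      Equiv.subtypeSubtypeEquivSubtype (p := fun I => I ≠ ⊥)
        (q := fun I => Ideal.absNorm I = n) fun hI hbot => hn (by rw [← hI, hbot]; simp)
    calc _ = ∑' _ : {I : {I : Ideal (𝓞 K) // I ≠ ⊥} // Ideal.absNorm I.1 = n},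
          (n : ℝ≥0∞) ^ (-s) := tsum_congr fun I => by
            simp only [Equiv.sigmaFiberEquiv_apply]
            rw [I.2]
      _ = _ := by
        rw [ENNReal.tsum_const, ENat.card_congr e, ENat.card_eq_coe_natCard]
        simp

theorem idealSum_eq_ofReal_dedekindZeta {K : Type*} [Field K] [NumberField K] {s : ℝ}
    (h : dedekindZeta K s ≠ 0) : idealSum K s = ENNReal.ofReal (dedekindZeta K s).re := by
  set c : ℕ → ℝ := fun n => if n = 0 then 0 else
    (Nat.card {I : Ideal (𝓞 K) // Ideal.absNorm I = n} : ℝ) * (n : ℝ) ^ (-s) with hc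
  have hc0 (n : ℕ) : 0 ≤ c n := by
    simp only [hc]
    split_ifs <;> positivity
  have hterm (n : ℕ) : LSeries.term
      (fun n ↦ (Nat.card {I : Ideal (𝓞 K) // Ideal.absNorm I = n} : ℂ)) s n = (c n : ℂ) := by
    rcases eq_or_ne n 0 with rfl | hn
    · simp [hc]
    · rw [LSeries.term_of_ne_zero hn]
      simp only [hc, if_neg hn]
      push_cast
      rw [Complex.ofReal_cpow (Nat.cast_nonneg n), div_eq_mul_inv, ← Complex.cpow_neg]
      simp
  have hzeta : dedekindZeta K s = ∑' n, (c n : ℂ) := tsum_congr hterm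
  have hsum : Summable c := by
    by_contra hns
    refine h (hzeta.trans (tsum_eq_zero_of_not_summable ?_))
    rwa [Complex.summable_ofReal]
  rw [hzeta, ← Complex.ofReal_tsum, Complex.ofReal_re, ENNReal.ofReal_tsum_of_nonneg hc0 hsum,
    idealSum_eq_tsum_card]
  refine tsum_congr fun n => ?_
  simp only [hc]
  split_ifs with hn
  · simp
  · rw [ENNReal.ofReal_mul (Nat.cast_nonneg _), ← ENNReal.ofReal_rpow_of_pos (by positivity)]
    simp

theorem tendsto_sub_one_mul_idealSum (K : Type*) [Field K] [NumberField K] :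
    Tendsto (fun s : ℝ => ENNReal.ofReal (s - 1) * idealSum K s) (𝓝[>] 1)
      (𝓝 (ENNReal.ofReal (dedekindZeta_residue K))) := by
  have hlim := tendsto_sub_one_mul_dedekindZeta_nhdsGT K
  have hre := (Complex.continuous_re.tendsto _).comp hlim
  rw [Complex.ofReal_re] at hre
  have hne := hlim.eventually_ne
    (Complex.ofReal_ne_zero.2 (dedekindZeta_residue_ne_zero K))
  refine (ENNReal.tendsto_ofReal hre).congr' ?_
  filter_upwards [hne, self_mem_nhdsWithin] with s hs hs1
  rw [idealSum_eq_ofReal_dedekindZeta (right_ne_zero_of_mul hs),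
    ← ENNReal.ofReal_mul (sub_nonneg.2 (le_of_lt hs1))]
  congr 1
  rw [Function.comp_apply, ← Complex.ofReal_one, ← Complex.ofReal_sub, Complex.re_ofReal_mul]

theorem one_lt_absNorm {F : Type*} [Field F] [NumberField F] (v : HeightOneSpectrum (𝓞 F)) :
    1 < Ideal.absNorm v.asIdeal := by
  have h0 : Ideal.absNorm v.asIdeal ≠ 0 := fun h => v.ne_bot (Ideal.absNorm_eq_zero_iff.1 h)
  have h1 : Ideal.absNorm v.asIdeal ≠ 1 :=
    fun h => v.isPrime.ne_top (Ideal.absNorm_eq_one_iff.1 h)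
  omega

theorem exists_two_primes_over {F K : Type*} [Field F] [NumberField F] [Field K] [NumberField K]
    [Algebra F K] (hdeg : Module.finrank F K = 2) (σ : K →ₐ[F] K) {u : (𝓞 F)ˣ} {r : 𝓞 K}
    (hr : r ^ 2 = algebraMap (𝓞 F) (𝓞 K) u) (hσ : σ r = -r)
    (v : HeightOneSpectrum (𝓞 F)) (h2 : (2 : 𝓞 F) ∉ v.asIdeal) {w : 𝓞 F}
    (hw : u - w ^ 2 ∈ v.asIdeal) :
    ∃ P Q : Ideal (𝓞 K), Prime P ∧ Prime Q ∧ P ≠ Q ∧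
      P.comap (algebraMap (𝓞 F) (𝓞 K)) = v.asIdeal ∧
      Q.comap (algebraMap (𝓞 F) (𝓞 K)) = v.asIdeal ∧
      Ideal.absNorm P = Ideal.absNorm v.asIdeal ∧ Ideal.absNorm Q = Ideal.absNorm v.asIdeal := by
  set τ : 𝓞 K →ₐ[𝓞 F] 𝓞 K := RingOfIntegers.mapAlgHom σ with hτ
  have hτr : τ r = -r := RingOfIntegers.ext hσ
  have := v.isMaximal
  obtain ⟨P₀, hP₀, hover⟩ :=
    Ideal.exists_maximal_ideal_liesOver_of_isIntegral (S := 𝓞 K) v.asIdeal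
  have hmem₀ (x : 𝓞 F) : algebraMap (𝓞 F) (𝓞 K) x ∈ P₀ ↔ x ∈ v.asIdeal :=
    (Ideal.mem_of_liesOver P₀ v.asIdeal x).symm
  obtain ⟨w', hw', hwP⟩ : ∃ w' : 𝓞 F, u - w' ^ 2 ∈ v.asIdeal ∧
      r - algebraMap (𝓞 F) (𝓞 K) w' ∈ P₀ := by
    have hprod : (r - algebraMap (𝓞 F) (𝓞 K) w) * (r - algebraMap (𝓞 F) (𝓞 K) (-w)) ∈ P₀ := by
      convert (hmem₀ _).2 hw using 1
      simp only [map_sub, map_neg, map_pow, ← hr]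
      ring
    rcases hP₀.isPrime.mem_or_mem hprod with h | h
    · exact ⟨w, hw, h⟩
    · exact ⟨-w, by simpa using hw, h⟩
  have hQover : (P₀.comap τ).LiesOver v.asIdeal :=
    ⟨by ext x; simp [Ideal.mem_comap, Ideal.under, hmem₀]⟩
  have hQprime : (P₀.comap τ).IsPrime := Ideal.IsPrime.comap τ
  have hne : P₀ ≠ P₀.comap τ := by
    intro h
    have h1 : τ (r - algebraMap (𝓞 F) (𝓞 K) w') ∈ P₀ := by
      rw [h] at hwP
      exact hwP
    rw [map_sub, hτr, AlgHom.commutes] at h1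
    have h3 : algebraMap (𝓞 F) (𝓞 K) (2 * w') ∈ P₀ := by
      convert P₀.neg_mem (P₀.add_mem hwP h1) using 1
      rw [map_mul, map_ofNat]
      ring
    rw [hmem₀] at h3
    have hwv : w' ∈ v.asIdeal := (v.isPrime.mem_or_mem h3).resolve_left h2
    refine v.isPrime.ne_top (Ideal.eq_top_of_isUnit_mem _ ?_ u.isUnit)
    convert v.asIdeal.add_mem hw' (v.asIdeal.mul_mem_left w' hwv) using 1
    ring
  have hPbot : P₀ ≠ ⊥ := Ideal.ne_bot_of_liesOver_of_ne_bot v.ne_bot P₀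
  have hQbot : P₀.comap τ ≠ ⊥ := Ideal.ne_bot_of_liesOver_of_ne_bot v.ne_bot (P₀.comap τ)
  have hP := Ideal.prime_of_isPrime hPbot hP₀.isPrime
  have hQ := Ideal.prime_of_isPrime hQbot hQprime
  set N := Ideal.absNorm v.asIdeal with hN
  have hN1 : 1 < N := one_lt_absNorm v
  have hge (I : Ideal (𝓞 K)) (hI : Prime I) [I.LiesOver v.asIdeal] : N ≤ Ideal.absNorm I := by
    have hpow := Ideal.absNorm_eq_pow_inertiaDeg'_of_liesOver I v.asIdeal v.isPrime v.ne_bot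
    rw [← hN] at hpow
    have hk : v.asIdeal.inertiaDeg' I ≠ 0 := by
      intro h
      rw [h, pow_zero] at hpow
      exact hI.not_isUnit (Ideal.isUnit_iff.2 (Ideal.absNorm_eq_one_iff.1 hpow))
    rw [hpow]
    exact Nat.le_self_pow hk N
  have hle : Ideal.absNorm P₀ * Ideal.absNorm (P₀.comap τ) ≤ N ^ 2 := by
    have hdvd : P₀ * P₀.comap τ ∣ v.asIdeal.map (algebraMap (𝓞 F) (𝓞 K)) := by
      have hQmax : (P₀.comap τ).IsMaximal := hQprime.isMaximal hQbot
      refine IsCoprime.mul_dvd (Ideal.isCoprime_of_isMaximal hne) ?_ ?_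
      · exact Ideal.dvd_iff_le.2 (Ideal.map_le_of_le_comap hover.over.le)
      · exact Ideal.dvd_iff_le.2 (Ideal.map_le_of_le_comap hQover.over.le)
    have hdeg' : Module.finrank (𝓞 F) (𝓞 K) = 2 := by
      rw [← hdeg]
      exact (IsFractionRing.finrank_eq (𝓞 F) F (𝓞 K) K).symm
    have := Ideal.absNorm_dvd_absNorm_of_le (Ideal.le_of_dvd hdvd)
    rw [Ideal.absNorm_algebraMap, hdeg', map_mul, ← hN] at this
    exact Nat.le_of_dvd (by positivity) this
  have h1 := hge P₀ hP
  have h3 := hge (P₀.comap τ) hQ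
  exact ⟨P₀, P₀.comap τ, hP, hQ, hne, hover.over.symm, hQover.over.symm,
    by nlinarith, by nlinarith⟩

theorem exists_sqrt_extension {F : Type} [Field F] [NumberField F] {u : (𝓞 F)ˣ}
    (hu : ∀ z : (𝓞 F)ˣ, u ≠ z ^ 2) :
    ∃ (K : Type) (_ : Field K) (_ : NumberField K) (_ : Algebra F K) (σ : K →ₐ[F] K) (r : 𝓞 K),
      Module.finrank F K = 2 ∧ r ^ 2 = algebraMap (𝓞 F) (𝓞 K) u ∧ σ r = -r := by
  have hF (b : F) : b ^ 2 ≠ ((u : 𝓞 F) : F) := by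
    intro hb
    have hintegral : IsIntegral ℤ b := by
      refine IsIntegral.of_pow (n := 2) two_pos ?_
      rw [hb]
      exact (u : 𝓞 F).2
    let z : 𝓞 F := ⟨b, hintegral⟩
    have hz : z ^ 2 = (u : 𝓞 F) := RingOfIntegers.ext hb
    have hunit : IsUnit z := (isUnit_pow_iff two_ne_zero).1 (hz ▸ u.isUnit)
    exact hu hunit.unit (Units.ext (by simpa using hz.symm))
  set p : Polynomial F := Polynomial.X ^ 2 - Polynomial.C ((u : 𝓞 F) : F) with hp
  have : Fact (Irreducible p) := ⟨X_pow_sub_C_irreducible_of_prime Nat.prime_two hF⟩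
  have hp0 : p ≠ 0 := (Fact.out : Irreducible p).ne_zero
  have : FiniteDimensional F (AdjoinRoot p) := (AdjoinRoot.powerBasis hp0).finite
  have : CharZero (AdjoinRoot p) := charZero_of_injective_algebraMap (algebraMap F _).injective
  have : FiniteDimensional ℚ (AdjoinRoot p) := FiniteDimensional.trans ℚ F _
  have hroot : AdjoinRoot.root p ^ 2 = algebraMap F (AdjoinRoot p) ((u : 𝓞 F) : F) := by
    have h := AdjoinRoot.eval₂_root p
    simp only [hp, Polynomial.eval₂_sub, Polynomial.eval₂_pow, Polynomial.eval₂_X,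
      Polynomial.eval₂_C] at h
    exact sub_eq_zero.1 h
  have hintegral : IsIntegral ℤ (AdjoinRoot.root p) := by
    refine IsIntegral.of_pow (n := 2) two_pos ?_
    rw [hroot]
    exact map_isIntegral_int _ (u : 𝓞 F).2
  refine ⟨AdjoinRoot p, inferInstance, ⟨⟩, inferInstance,
    AdjoinRoot.liftAlgHom p (Algebra.ofId F _) (-AdjoinRoot.root p) ?_,
    ⟨AdjoinRoot.root p, hintegral⟩, ?_, RingOfIntegers.ext hroot, ?_⟩
  · simp only [hp, Polynomial.eval₂_sub, Polynomial.eval₂_pow, Polynomial.eval₂_X,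
      Polynomial.eval₂_C, neg_sq]
    exact sub_eq_zero.2 hroot
  · rw [(AdjoinRoot.powerBasis hp0).finrank, AdjoinRoot.powerBasis_dim, hp]
    exact Polynomial.natDegree_X_pow_sub_C
  · exact AdjoinRoot.liftAlgHom_root ..

theorem natCast_rpow_neg_le_inv_two {n : ℕ} (hn : 1 < n) {s : ℝ} (hs : 1 ≤ s) :
    (n : ℝ≥0∞) ^ (-s) ≤ 2⁻¹ := by
  rw [ENNReal.rpow_neg, ENNReal.inv_le_inv]
  have h1 : (1 : ℝ≥0∞) ≤ n := by exact_mod_cast hn.le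
  calc (2 : ℝ≥0∞) ≤ n := by exact_mod_cast hn
    _ = (n : ℝ≥0∞) ^ (1 : ℝ) := (ENNReal.rpow_one _).symm
    _ ≤ (n : ℝ≥0∞) ^ s := ENNReal.rpow_le_rpow_of_exponent_le h1 hs

/-- If each prime of `F` outside a finite set `T` has two distinct primes of `K` of the same norm
above it, then `ζ_F ^ 2` is bounded by a multiple of `ζ_K`, contradicting the simple poles. -/
theorem exists_not_split {F K : Type*} [Field F] [NumberField F] [Field K] [NumberField K]
    [Algebra F K] (T : Finset (HeightOneSpectrum (𝓞 F))) :
    ∃ v ∉ T, ¬ ∃ P Q : Ideal (𝓞 K), Prime P ∧ Prime Q ∧ P ≠ Q ∧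
      P.comap (algebraMap (𝓞 F) (𝓞 K)) = v.asIdeal ∧
      Q.comap (algebraMap (𝓞 F) (𝓞 K)) = v.asIdeal ∧
      Ideal.absNorm P = Ideal.absNorm v.asIdeal ∧ Ideal.absNorm Q = Ideal.absNorm v.asIdeal := by
  by_contra! hsplit
  choose P Q hP hQ hPQ hPv hQv hPN hQN using
    fun v : {v : HeightOneSpectrum (𝓞 F) // v ∉ T} => hsplit v.1 v.2
  have hinj : Function.Injective (Sum.elim P Q) := by
    refine Function.Injective.sumElim (fun a b h => ?_) (fun a b h => ?_) (fun a b h => ?_)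
    · exact Subtype.ext (HeightOneSpectrum.ext (by rw [← hPv, h, hPv]))
    · exact Subtype.ext (HeightOneSpectrum.ext (by rw [← hQv, h, hQv]))
    · obtain rfl : a = b := Subtype.ext (HeightOneSpectrum.ext (by rw [← hPv, h, hQv]))
      exact hPQ a h
  have hbound {s : ℝ} (hs : 1 ≤ s) (hfin : idealSum F s ≠ ⊤) :
      idealSum F s ^ 2 ≤ (2 ^ T.card) ^ 2 * idealSum K s := by
    set f : {v : HeightOneSpectrum (𝓞 F) // v ∉ T} → ℝ≥0∞ :=
      fun v => (Ideal.absNorm v.1.asIdeal : ℝ≥0∞) ^ (-s) with hf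
    have h1 : idealSum F s ≤ 2 ^ T.card * multisetSum f := by
      rw [idealSum_eq_multisetSum] at hfin ⊢
      exact multisetSum_le_two_pow_mul
        (fun v => natCast_rpow_neg_le_inv_two (one_lt_absNorm v) hs) hfin T
    have h2 : multisetSum f ^ 2 ≤ idealSum K s := by
      rw [sq]
      refine (multisetSum_mul_le f f).trans ((multisetSum_mono ?_).trans
        (multisetSum_absNorm_le_idealSum hinj (Sum.rec hP hQ) s))
      rintro (v | v)
      · simp [hf, hPN]
      · simp [hf, hQN]
    calc idealSum F s ^ 2 ≤ (2 ^ T.card * multisetSum f) ^ 2 := by gcongr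
      _ = (2 ^ T.card) ^ 2 * multisetSum f ^ 2 := mul_pow _ _ _
      _ ≤ _ := by gcongr
  have hF := tendsto_sub_one_mul_idealSum F
  have hK := tendsto_sub_one_mul_idealSum K
  have hsub : Tendsto (fun s : ℝ => ENNReal.ofReal (s - 1)) (𝓝[>] 1) (𝓝 0) := by
    have : Tendsto (fun s : ℝ => s - 1) (𝓝[>] 1) (𝓝 (1 - 1)) :=
      ((continuous_sub_right (1 : ℝ)).tendsto 1).mono_left nhdsWithin_le_nhds
    simpa using ENNReal.tendsto_ofReal this
  have hupper : Tendsto (fun s : ℝ => (2 ^ T.card) ^ 2 *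
      (ENNReal.ofReal (s - 1) * (ENNReal.ofReal (s - 1) * idealSum K s))) (𝓝[>] 1) (𝓝 0) := by
    have := ENNReal.Tendsto.const_mul (a := ((2 : ℝ≥0∞) ^ T.card) ^ 2)
      (ENNReal.Tendsto.mul hsub (Or.inr ENNReal.ofReal_ne_top) hK (Or.inr ENNReal.zero_ne_top))
      (Or.inr (by finiteness))
    simpa using this
  have hlower := ENNReal.Tendsto.pow (n := 2) hF
  have hle := le_of_tendsto_of_tendsto hlower hupper (by
    filter_upwards [self_mem_nhdsWithin, hF.eventually_ne ENNReal.ofReal_ne_top] with s hs hfin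
    have hpos : ENNReal.ofReal (s - 1) ≠ 0 := by
      simpa using hs
    have hfin' : idealSum F s ≠ ⊤ := fun h => hfin (by rw [h, ENNReal.mul_top hpos])
    calc (ENNReal.ofReal (s - 1) * idealSum F s) ^ 2
        = ENNReal.ofReal (s - 1) ^ 2 * idealSum F s ^ 2 := mul_pow _ _ _
      _ ≤ ENNReal.ofReal (s - 1) ^ 2 * ((2 ^ T.card) ^ 2 * idealSum K s) := by
        gcongr
        exact hbound (le_of_lt hs) hfin'
      _ = _ := by ring)
  have hzero := pow_eq_zero_iff two_ne_zero |>.1 (le_antisymm hle bot_le)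
  exact (dedekindZeta_residue_pos F).not_ge (ENNReal.ofReal_eq_zero.1 hzero)

theorem exists_unit_not_square_mod {F : Type} [Field F] [NumberField F] {u : (𝓞 F)ˣ}
    (hu : ∀ z : (𝓞 F)ˣ, u ≠ z ^ 2) (T : Finset (HeightOneSpectrum (𝓞 F))) :
    ∃ v ∉ T, ∀ w : 𝓞 F, (u : 𝓞 F) - w ^ 2 ∉ v.asIdeal := by
  classical
  obtain ⟨K, _, _, _, σ, r, hdeg, hr, hσ⟩ := exists_sqrt_extension hu
  have hfin : {v : HeightOneSpectrum (𝓞 F) | v.asIdeal ∣ Ideal.span {(2 : 𝓞 F)}}.Finite :=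
    Ideal.finite_factors (by simp)
  obtain ⟨v, hvT, hv⟩ := exists_not_split (K := K) (T ∪ hfin.toFinset)
  simp only [Finset.mem_union, Set.Finite.mem_toFinset, Set.mem_ofPred_eq, not_or,
    Ideal.dvd_span_singleton] at hvT
  exact ⟨v, hvT.1, fun w hw => hv (exists_two_primes_over hdeg σ hr hσ v hvT.2 hw)⟩

theorem finite_units_mod_squares (F : Type*) [Field F] [NumberField F] :
    Finite ((𝓞 F)ˣ ⧸ (powMonoidHom 2 : (𝓞 F)ˣ →* (𝓞 F)ˣ).range) := by
  have : Group.FG (𝓞 F)ˣ := Group.fg_iff_monoid_fg.2 inferInstance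
  exact CommGroup.finite_of_fg_isMulTorsion _
    (CommGroup.isMulTorsion_quotient_range_powMonoidHom _ two_ne_zero)

/-- Let `F` be a number field and `P₀` a finite set of finite places of
`F` (nonzero primes of `𝓞 F`). Then there is a finite set `S` of finite places, disjoint
from `P₀`, such that the natural map `𝓞_F^×/(𝓞_F^×)² → ∏_{v ∈ S} k(v)^×/(k(v)^×)²` is
injective; equivalently, every unit of `𝓞 F` which is a square in every residue field
`k(v)`, `v ∈ S`, is a square in `𝓞 F`. -/
theorem exists_auxiliary_set_units_injective_mod_squares
    (F : Type) [Field F] [NumberField F]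
    (P₀ : Finset (HeightOneSpectrum (𝓞 F))) :
    ∃ S : Finset (HeightOneSpectrum (𝓞 F)),
      (∀ v ∈ S, v ∉ P₀) ∧
      ∀ u : (𝓞 F)ˣ,
        (∀ v ∈ S, ∃ w : ((𝓞 F) ⧸ v.asIdeal)ˣ,
          Units.map (Ideal.Quotient.mk v.asIdeal).toMonoidHom u = w ^ 2) →
        ∃ z : (𝓞 F)ˣ, u = z ^ 2 := by
  classical
  have := finite_units_mod_squares F
  have := Fintype.ofFinite ((𝓞 F)ˣ ⧸ (powMonoidHom 2 : (𝓞 F)ˣ →* (𝓞 F)ˣ).range)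
  have hex (q : (𝓞 F)ˣ ⧸ (powMonoidHom 2 : (𝓞 F)ˣ →* (𝓞 F)ˣ).range) :
      ∃ s : Finset (HeightOneSpectrum (𝓞 F)), (∀ v ∈ s, v ∉ P₀) ∧
        ((∀ z, q.out ≠ z ^ 2) → ∃ v ∈ s, ∀ w : 𝓞 F, (q.out : 𝓞 F) - w ^ 2 ∉ v.asIdeal) := by
    by_cases hq : ∀ z, q.out ≠ z ^ 2
    · obtain ⟨v, hv, hw⟩ := exists_unit_not_square_mod hq P₀
      exact ⟨{v}, by simpa using hv, fun _ => ⟨v, by simp, hw⟩⟩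
    · exact ⟨∅, by simp, fun h => absurd h hq⟩
  choose s hsP hs using hex
  refine ⟨Finset.univ.biUnion s, ?_, fun u hu => ?_⟩
  · intro v hv
    obtain ⟨q, -, hq⟩ := Finset.mem_biUnion.1 hv
    exact hsP q v hq
  · by_contra! hsq
    set q : (𝓞 F)ˣ ⧸ (powMonoidHom 2 : (𝓞 F)ˣ →* (𝓞 F)ˣ).range := QuotientGroup.mk u with hq
    obtain ⟨⟨_, t, rfl⟩, ht⟩ := QuotientGroup.mk_out_eq_mul
      (powMonoidHom 2 : (𝓞 F)ˣ →* (𝓞 F)ˣ).range u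
    rw [← hq] at ht
    simp only [powMonoidHom_apply] at ht
    obtain ⟨v, hvs, hv⟩ := hs q (fun z hz => hsq (z * t⁻¹) (by
      rw [mul_pow, ← hz, ht, inv_pow, mul_inv_cancel_right]))
    obtain ⟨w, hw⟩ := hu v (Finset.mem_biUnion.2 ⟨q, Finset.mem_univ _, hvs⟩)
    obtain ⟨x, hx⟩ := Ideal.Quotient.mk_surjective (w : 𝓞 F ⧸ v.asIdeal)
    refine hv (x * t) (Ideal.Quotient.eq.1 ?_)
    have hw' : Ideal.Quotient.mk v.asIdeal u = (w : 𝓞 F ⧸ v.asIdeal) ^ 2 := congrArg Units.val hw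
    rw [ht, Units.val_mul, Units.val_pow_eq_pow_val, map_mul, hw', ← hx, mul_pow, map_mul, map_pow,
      map_pow]
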